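/- Let n ≥ 3 be an integer. There exists a constant c_n > 0 depending only on n such that for every integer s ≥ 1 and every real T ≥ 1, the average of the normalized s-Frobenius number over G(T) satisfies (1/#G(T)) · Σ_{a ∈ G(T)} X_s(a) ≤ c_n, where G(T) = {a ∈ ℤ^n_{>0} : gcd(a_1,…,a_n) = 1, max_i a_i ≤ T} and X_s(a) = F_s(a)/(s·a_1·…·a_n)^{1/(n-1)}. -/

import Mathlib

namespace SFrob

/-- distance to zero in `ZMod m` -/
def nrm {m : ℕ} (x : ZMod m) : ℕ := x.valMinAbs.natAbs

lemma nrm_eq_zero {m : ℕ} (x : ZMod m) : nrm x = 0 ↔ x = 0 := by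
  simp [nrm, ZMod.valMinAbs_eq_zero]

lemma norm_char {m : ℕ} [NeZero m] (x : ZMod m) : ‖(ZMod.stdAddChar x : ℂ)‖ = 1 :=
  Circle.norm_coe (ZMod.toCircle x)

lemma char_sum {m : ℕ} [NeZero m] {ι : Type*} (s : Finset ι) (f : ι → ZMod m) :
    (ZMod.stdAddChar (∑ i ∈ s, f i) : ℂ) = ∏ i ∈ s, ZMod.stdAddChar (f i) := by
  classical
  induction s using Finset.induction_on with
  | empty => simp
  | insert i s hi ih => rw [Finset.sum_insert hi, Finset.prod_insert hi, AddChar.map_add_eq_mul, ih]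

lemma geom_bound {m : ℕ} [NeZero m] (x : ZMod m) (N : ℕ) :
    ‖∑ z ∈ Finset.range N, (ZMod.stdAddChar (x * (z : ZMod m)) : ℂ)‖ * (nrm x : ℝ) ≤ m := by
  have hm : (0:ℝ) < m := by exact_mod_cast Nat.pos_of_ne_zero (NeZero.ne m)
  set ω : ℂ := ZMod.stdAddChar x with hω
  have hsum : ∑ z ∈ Finset.range N, (ZMod.stdAddChar (x * (z : ZMod m)) : ℂ)
      = ∑ z ∈ Finset.range N, ω ^ z := by
    refine Finset.sum_congr rfl fun z _ => ?_
    rw [hω, ← AddChar.map_nsmul_eq_pow]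
    congr 1
    simp [mul_comm]
  have hnorm : ‖ω‖ = 1 := norm_char x
  rw [hsum]
  have h1 : ‖∑ z ∈ Finset.range N, ω ^ z‖ * ‖ω - 1‖ ≤ 2 := by
    rw [← norm_mul, geom_sum_mul]
    calc ‖ω ^ N - 1‖ ≤ ‖ω ^ N‖ + ‖(1:ℂ)‖ := norm_sub_le _ _
      _ = 2 := by rw [norm_pow, hnorm]; norm_num
  have h2 : (2 * (nrm x : ℝ)) / m ≤ ‖ω - 1‖ := by
    have e1 : ω = Complex.exp (Complex.I * ((2 * Real.pi * (x.valMinAbs : ℝ) / m : ℝ) : ℂ)) := by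
      rw [hω]
      conv_lhs => rw [← ZMod.coe_valMinAbs x]
      rw [ZMod.stdAddChar_coe]
      congr 1
      push_cast
      ring
    rw [e1, Complex.norm_exp_I_mul_ofReal_sub_one, norm_mul]
    have hj := ZMod.natAbs_valMinAbs_le x
    have hj' : (2:ℝ) * |(x.valMinAbs : ℝ)| ≤ m := by
      have : 2 * x.valMinAbs.natAbs ≤ m := by omega
      have h3 : (2:ℝ) * (x.valMinAbs.natAbs : ℝ) ≤ m := by exact_mod_cast this
      rwa [Nat.cast_natAbs, Int.cast_abs] at h3
    have hpi := Real.pi_pos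
    have h4 : |2 * Real.pi * (x.valMinAbs : ℝ) / m / 2| = Real.pi * |(x.valMinAbs : ℝ)| / m := by
      rw [show 2 * Real.pi * (x.valMinAbs : ℝ) / m / 2 = Real.pi * (x.valMinAbs : ℝ) / m by ring,
        abs_div, abs_mul, abs_of_pos hpi, abs_of_pos hm]
    have h5 := Real.mul_abs_le_abs_sin (x := 2 * Real.pi * (x.valMinAbs : ℝ) / m / 2) (by
      rw [h4, div_le_div_iff₀ hm two_pos]
      nlinarith)
    rw [h4] at h5
    have h6 : (nrm x : ℝ) = |(x.valMinAbs : ℝ)| := by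
      rw [nrm, Nat.cast_natAbs, Int.cast_abs]
    rw [h6, Real.norm_eq_abs, Real.norm_eq_abs, abs_two]
    have h7 : 2 / Real.pi * (Real.pi * |(x.valMinAbs : ℝ)| / m) = 2 * |(x.valMinAbs : ℝ)| / m := by
      field_simp
    rw [h7] at h5
    have : 0 ≤ 2 * |(x.valMinAbs : ℝ)| / m := by positivity
    linarith
  have h3 : ‖∑ z ∈ Finset.range N, ω ^ z‖ * ((2 * (nrm x : ℝ)) / m) ≤ 2 :=
    (mul_le_mul_of_nonneg_left h2 (norm_nonneg _)).trans h1
  rw [mul_div_assoc', div_le_iff₀ hm] at h3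
  linarith

lemma cell_sum : ∃ A : ℝ, 0 < A ∧ ∀ S : Finset ℤ, ∑ k ∈ S, 5 / (1 + (k:ℝ)^2) ≤ A := by
  have hs : Summable (fun k : ℤ => 5 / (1 + (k:ℝ)^2)) := by
    have h1 : Summable (fun k : ℤ => 1 / (k:ℝ)^2) := Real.summable_one_div_int_pow.2 (by norm_num)
    have h2 : Summable (fun k : ℤ => 5 * (1 / (k:ℝ)^2) + (if k = 0 then (5:ℝ) else 0)) := by
      refine (h1.mul_left 5).add ?_
      exact summable_of_ne_finset_zero (s := {0}) (by intro b hb; simp at hb; simp [hb])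
    refine Summable.of_nonneg_of_le (fun k => by positivity) (fun k => ?_) h2
    by_cases hk : k = 0
    · simp [hk]
    · have : (0:ℝ) < (k:ℝ)^2 := by positivity
      simp only [hk, if_false, add_zero]
      rw [mul_one_div]
      gcongr
      linarith
  refine ⟨(∑' k : ℤ, 5 / (1 + (k:ℝ)^2)) + 1, ?_, fun S => ?_⟩
  · have : 0 ≤ ∑' k : ℤ, 5 / (1 + (k:ℝ)^2) := tsum_nonneg fun k => by positivity
    linarith
  · have := hs.sum_le_tsum S (fun k _ => by positivity)
    linarith

lemma cell_bound (φ : ℝ) (h0 : 0 ≤ φ) (h1 : φ ≤ 1) (e : ℤ) (ρ : ℕ) (hρ : 1 ≤ ρ)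
    (h2 : φ * (e.natAbs : ℝ) ≤ ρ) : φ ^ 2 ≤ 5 / (1 + ((e / (ρ:ℤ) : ℤ) : ℝ)^2) := by
  set k : ℤ := e / (ρ:ℤ) with hk
  have hρ' : (0:ℤ) < ρ := by exact_mod_cast hρ
  have hρr : (0:ℝ) < ρ := by exact_mod_cast hρ
  have hk1 : k * ρ ≤ e := Int.ediv_mul_le _ hρ'.ne'
  have hk2 : e < (k + 1) * ρ := Int.lt_ediv_add_one_mul_self _ hρ'
  rw [le_div_iff₀ (by positivity)]
  have habs : (e.natAbs : ℝ) = |(e:ℝ)| := by rw [Nat.cast_natAbs, Int.cast_abs]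
  rw [habs] at h2
  have hk1' : (k:ℝ) * ρ ≤ e := by exact_mod_cast hk1
  have hk2' : (e:ℝ) < ((k:ℝ) + 1) * ρ := by exact_mod_cast hk2
  have key : ∀ c : ℝ, 0 ≤ c → c * ρ ≤ |(e:ℝ)| → φ * c ≤ 1 := by
    intro c hc h
    have : φ * (c * ρ) ≤ ρ := (mul_le_mul_of_nonneg_left h h0).trans h2
    by_contra! h'
    nlinarith
  have hsq : φ ^ 2 ≤ 1 := by nlinarith
  rcases lt_trichotomy k (-1) with h | h | h
  · have hkr : (k:ℝ) ≤ -2 := by exact_mod_cast (by omega : k ≤ -2)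
    have := key (-(k:ℝ) - 1) (by linarith) (by
      refine le_trans ?_ (neg_le_abs _)
      linarith)
    have h3 : 0 ≤ φ * (-(k:ℝ) - 1) := mul_nonneg h0 (by linarith)
    have h4 : (φ * (-(k:ℝ) - 1))^2 ≤ 1 := by nlinarith
    have h5 : 1 + (k:ℝ)^2 ≤ 5 * (-(k:ℝ) - 1)^2 := by nlinarith
    nlinarith [mul_le_mul_of_nonneg_left h5 (sq_nonneg φ)]
  · rw [h]; norm_num; linarith
  · have hkr : (0:ℝ) ≤ k := by exact_mod_cast (by omega : 0 ≤ k)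
    have := key k hkr (hk1'.trans (le_abs_self _))
    have h3 : 0 ≤ φ * k := mul_nonneg h0 hkr
    nlinarith

lemma nrm_sub_lt {m : ℕ} [NeZero m] (x y : ZMod m) (ρ : ℕ) (hρ : 1 ≤ ρ)
    (h : x.valMinAbs / (ρ:ℤ) = y.valMinAbs / (ρ:ℤ)) : nrm (x - y) < ρ := by
  have hρ' : (0:ℤ) < ρ := by exact_mod_cast hρ
  have h1 : nrm (x - y) ≤ (x.valMinAbs - y.valMinAbs).natAbs := by
    apply ZMod.natAbs_min_of_le_div_two m
    · push_cast
      simp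
    · exact ZMod.natAbs_valMinAbs_le _
  have hk1 := Int.ediv_mul_le x.valMinAbs hρ'.ne'
  have hk2 := Int.lt_ediv_add_one_mul_self x.valMinAbs hρ'
  have hk3 := Int.ediv_mul_le y.valMinAbs hρ'.ne'
  have hk4 := Int.lt_ediv_add_one_mul_self y.valMinAbs hρ'
  rw [h] at hk1 hk2
  have : (x.valMinAbs - y.valMinAbs).natAbs < ρ := by
    rw [add_mul] at hk2 hk4
    omega
  omega

lemma fourier_cover (n : ℕ) : ∃ K : ℕ, 1 ≤ K ∧ ∀ (m : ℕ) [NeZero m] (a : Fin n → ZMod m)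
    (ρ N : ℕ), 1 ≤ ρ → 1 ≤ N → K * m ≤ N * ρ →
    (∀ h : ZMod m, h ≠ 0 → ∃ i, ρ ≤ nrm (h * a i)) →
    ∀ r : ZMod m, ∃ z : Fin n → ℕ, (∀ i, z i < 4 * N) ∧ ∑ i, a i * (z i : ZMod m) = r := by
  obtain ⟨A, hA, hAS⟩ := cell_sum
  obtain ⟨K, hK⟩ := exists_nat_gt (max 1 (A ^ n))
  have hK1 : (1:ℝ) < K := (le_max_left _ _).trans_lt hK
  have hKA : A ^ n < K := (le_max_right _ _).trans_lt hK
  refine ⟨K, by exact_mod_cast hK1.le, ?_⟩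
  intro m _ a ρ N hρ hN hKN hgood r
  by_contra! hno
  have hNr : (0:ℝ) < N := by exact_mod_cast hN
  have hρr : (0:ℝ) < ρ := by exact_mod_cast hρ
  have hKNr : (K:ℝ) * m ≤ N * ρ := by exact_mod_cast hKN
  let D : ZMod m → ℂ := fun x => ∑ z ∈ Finset.range N, ZMod.stdAddChar (x * (z : ZMod m))
  let φ : ZMod m → ℝ := fun x => ‖D x‖ / N
  have hφ0 : ∀ x, 0 ≤ φ x := fun x => by positivity
  have hφ1 : ∀ x, φ x ≤ 1 := by
    intro x
    rw [div_le_one hNr]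
    refine (norm_sum_le _ _).trans ?_
    simp [norm_char]
  have hφ2 : ∀ x, φ x * nrm x * K ≤ ρ := by
    intro x
    have := geom_bound x N
    have h1 : φ x * nrm x = (‖D x‖ * nrm x) / N := by simp only [φ]; ring
    rw [h1, div_mul_eq_mul_div, div_le_iff₀ hNr]
    nlinarith
  -- orthogonality
  have horth : ∑ h : ZMod m, ZMod.stdAddChar (h * (-r)) * ∏ i, (D (h * a i))^4 = 0 := by
    have : ∀ h : ZMod m, ZMod.stdAddChar (h * (-r)) * ∏ i, (D (h * a i))^4
        = ∑ w ∈ Fintype.piFinset (fun _ : Fin n × Fin 4 => Finset.range N),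
          ZMod.stdAddChar (h * ((∑ i, a i * ((∑ j, w (i, j) : ℕ) : ZMod m)) - r)) := by
      intro h
      have e1 : ∏ i, (D (h * a i))^4 = ∏ ij : Fin n × Fin 4, D (h * a ij.1) := by
        rw [Fintype.prod_prod_type]
        simp
      rw [e1, Finset.prod_univ_sum, Finset.mul_sum]
      refine Finset.sum_congr rfl fun w _ => ?_
      have e2 : ∏ x : Fin n × Fin 4, (ZMod.stdAddChar (h * a x.1 * (w x : ZMod m)) : ℂ)
         = ZMod.stdAddChar (∑ x : Fin n × Fin 4, h * a x.1 * (w x : ZMod m)) := by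
        rw [char_sum]
      rw [e2, ← AddChar.map_add_eq_mul]
      congr 1
      rw [Fintype.sum_prod_type]
      push_cast
      simp_rw [mul_sub, Finset.mul_sum, mul_assoc]
      ring
    simp_rw [this]
    rw [Finset.sum_comm]
    refine Finset.sum_eq_zero fun w hw => ?_
    rw [AddChar.sum_mulShift _ (ZMod.isPrimitive_stdAddChar m), if_neg]
    · simp
    · rw [sub_eq_zero]
      apply hno
      intro i
      have hw' : ∀ j, w (i, j) < N := fun j => by
        have := Fintype.mem_piFinset.1 hw (i, j)
        simpa using this
      rw [Fin.sum_univ_four]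
      have := hw' 0; have := hw' 1; have := hw' 2; have := hw' 3
      omega
  -- isolate h = 0
  have hsplit : (N:ℝ) ^ (4 * n) ≤ ∑ h ∈ Finset.univ.erase (0 : ZMod m), ∏ i, ‖D (h * a i)‖ ^ 4 := by
    rw [← Finset.add_sum_erase _ _ (Finset.mem_univ (0 : ZMod m))] at horth
    have h0 : ZMod.stdAddChar ((0 : ZMod m) * (-r)) * ∏ i, (D ((0 : ZMod m) * a i))^4
        = ((N : ℂ)) ^ (4 * n) := by
      simp [D, pow_mul]
    rw [h0] at horth
    have := eq_neg_of_add_eq_zero_left horth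
    calc (N:ℝ) ^ (4 * n) = ‖(N : ℂ) ^ (4 * n)‖ := by simp
      _ = ‖∑ h ∈ Finset.univ.erase (0 : ZMod m),
            ZMod.stdAddChar (h * (-r)) * ∏ i, (D (h * a i))^4‖ := by rw [this, norm_neg]
      _ ≤ _ := by
        refine (norm_sum_le _ _).trans (Finset.sum_le_sum fun h _ => ?_)
        simp [norm_char]
  have hsplit2 : (1:ℝ) ≤ ∑ h ∈ Finset.univ.erase (0 : ZMod m), ∏ i, φ (h * a i) ^ 4 := by
    have : ∀ h : ZMod m, ∏ i, φ (h * a i) ^ 4 = (∏ i, ‖D (h * a i)‖ ^ 4) / (N:ℝ)^(4*n) := by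
      intro h
      simp only [φ, div_pow, Finset.prod_div_distrib]
      simp [pow_mul]
    simp_rw [this]
    rw [← Finset.sum_div, le_div_iff₀ (by positivity), one_mul]
    exact hsplit
  have hcell : ∑ h : ZMod m, ∏ i, φ (h * a i) ^ 2 ≤ A ^ n := by
    let cell : ZMod m → (Fin n → ℤ) := fun h i => (h * a i).valMinAbs / (ρ:ℤ)
    have hinj : Function.Injective cell := by
      intro h h' hh
      by_contra hne
      obtain ⟨i, hi⟩ := hgood (h - h') (sub_ne_zero.2 hne)
      rw [sub_mul] at hi
      exact absurd (nrm_sub_lt _ _ ρ hρ (congrFun hh i)) (not_lt.2 hi)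
    let S : Fin n → Finset ℤ := fun i => Finset.univ.image (fun h => cell h i)
    calc ∑ h : ZMod m, ∏ i, φ (h * a i) ^ 2
        ≤ ∑ h : ZMod m, ∏ i, 5 / (1 + ((cell h i : ℤ) : ℝ)^2) := by
          refine Finset.sum_le_sum fun h _ => Finset.prod_le_prod (fun i _ => by positivity) ?_
          intro i _
          refine cell_bound _ (hφ0 _) (hφ1 _) _ ρ hρ ?_
          have := hφ2 (h * a i)
          have h3 : 0 ≤ φ (h * a i) * (nrm (h * a i) : ℝ) := mul_nonneg (hφ0 _) (by positivity)
          have h4 : φ (h * a i) * (nrm (h * a i) : ℝ) ≤ ρ := by nlinarith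
          exact h4
      _ = ∑ k ∈ Finset.univ.image cell, ∏ i, 5 / (1 + ((k i : ℤ) : ℝ)^2) := by
          rw [Finset.sum_image (fun _ _ _ _ h => hinj h)]
      _ ≤ ∑ k ∈ Fintype.piFinset S, ∏ i, 5 / (1 + ((k i : ℤ) : ℝ)^2) := by
          refine Finset.sum_le_sum_of_subset_of_nonneg ?_ fun k _ _ => by positivity
          intro k hk
          obtain ⟨h, _, rfl⟩ := Finset.mem_image.1 hk
          rw [Fintype.mem_piFinset]
          intro i
          exact Finset.mem_image_of_mem _ (Finset.mem_univ h)
      _ = ∏ i, ∑ k ∈ S i, 5 / (1 + (k : ℝ)^2) := by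
          rw [Finset.prod_univ_sum]
      _ ≤ ∏ i : Fin n, A := Finset.prod_le_prod
          (fun i _ => Finset.sum_nonneg fun k _ => by positivity) (fun i _ => hAS _)
      _ = A ^ n := by simp
  have hfin : ∑ h ∈ Finset.univ.erase (0 : ZMod m), ∏ i, φ (h * a i) ^ 4 ≤ A ^ n / K := by
    have : ∀ h ∈ Finset.univ.erase (0 : ZMod m), ∏ i, φ (h * a i) ^ 4
        ≤ (∏ i, φ (h * a i) ^ 2) * (1 / K) := by
      intro h hh
      obtain ⟨i, hi⟩ := hgood h (Finset.ne_of_mem_erase hh)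
      have e : ∏ i, φ (h * a i) ^ 4 = (∏ i, φ (h * a i) ^ 2) * ∏ i, φ (h * a i) ^ 2 := by
        rw [← Finset.prod_mul_distrib]
        exact Finset.prod_congr rfl fun i _ => by ring
      rw [e]
      refine mul_le_mul_of_nonneg_left ?_ (Finset.prod_nonneg fun i _ => by positivity)
      have h1 : φ (h * a i) ≤ 1 / K := by
        rw [le_div_iff₀ (by linarith)]
        have h2 := hφ2 (h * a i)
        have h3 : (ρ:ℝ) ≤ nrm (h * a i) := by exact_mod_cast hi
        have h4 : φ (h * a i) * ρ * K ≤ φ (h * a i) * nrm (h * a i) * K := by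
          have := hφ0 (h * a i)
          gcongr
        by_contra! h5
        nlinarith
      rw [← Finset.mul_prod_erase _ _ (Finset.mem_univ i)]
      have h6 : ∏ j ∈ Finset.univ.erase i, φ (h * a j) ^ 2 ≤ 1 :=
        Finset.prod_le_one (fun j _ => by positivity)
          (fun j _ => pow_le_one₀ (hφ0 _) (hφ1 _))
      have h7 : φ (h * a i) ^ 2 ≤ φ (h * a i) := by
        have := hφ0 (h * a i); have := hφ1 (h * a i); nlinarith
      calc _ ≤ φ (h * a i) ^ 2 * 1 := mul_le_mul_of_nonneg_left h6 (by positivity)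
        _ ≤ 1 / K := by linarith
    refine (Finset.sum_le_sum this).trans ?_
    rw [← Finset.sum_mul, mul_one_div]
    refine div_le_div_of_nonneg_right (le_trans ?_ hcell) (by linarith)
    exact Finset.sum_le_sum_of_subset_of_nonneg (Finset.erase_subset _ _)
      (fun h _ _ => Finset.prod_nonneg fun i _ => by positivity)
  have : A ^ n / K < 1 := by rw [div_lt_one (by linarith)]; exact hKA
  linarith

lemma pow_sum_aux (β : ℝ) (h0 : 0 ≤ β) (h1 : β < 1) (g : ℕ) :
    ∑ l ∈ Finset.Icc 1 g, (l:ℝ) ^ (-β) ≤ (g:ℝ) ^ (1 - β) / (1 - β) := by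
  induction g with
  | zero =>
    simp only [zero_lt_one, Finset.Icc_eq_empty_of_lt, Finset.sum_empty, Nat.cast_zero]
    rw [Real.zero_rpow (by linarith)]
    simp
  | succ g ih =>
    rw [Finset.sum_Icc_succ_top (by omega)]
    refine (add_le_add_left ih _).trans ?_
    have hb : 0 < 1 - β := by linarith
    have hx : (0:ℝ) < ((g+1 : ℕ):ℝ) := by positivity
    set x : ℝ := ((g+1 : ℕ):ℝ) with hxdef
    have hg : (g:ℝ) = x * (1 + (-(1/x))) := by
      field_simp
      rw [hxdef]; push_cast; ring
    have hx1 : 1 / x ≤ 1 := by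
      rw [div_le_one hx, hxdef]; push_cast; linarith [(Nat.cast_nonneg g : (0:ℝ) ≤ g)]
    have h2 := rpow_one_add_le_one_add_mul_self (s := -(1/x)) (by linarith) (p := 1 - β) hb.le
      (by linarith)
    have h3 : (g:ℝ) ^ (1 - β) ≤ x ^ (1-β) * (1 + (1-β) * (-(1/x))) := by
      rw [hg, Real.mul_rpow hx.le (by linarith)]
      exact mul_le_mul_of_nonneg_left h2 (by positivity)
    have h4 : x ^ (1-β) * (1/x) = x ^ (-β) := by
      rw [show (1 - β) = -β + 1 by ring, Real.rpow_add hx, Real.rpow_one]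
      field_simp
    rw [div_add' _ _ _ hb.ne', div_le_div_iff_of_pos_right hb]
    have : x ^ (1-β) * (1 + (1-β) * (-(1/x))) = x ^ (1-β) - (1-β) * (x ^ (1-β) * (1/x)) := by ring
    rw [this, h4] at h3
    linarith

lemma pow_sum (β : ℝ) (h0 : 0 ≤ β) (h1 : β < 1) (g : ℕ) :
    ∑ l ∈ Finset.Icc 1 g, ((g:ℝ) / l) ^ β ≤ 1 / (1 - β) * g := by
  rcases Nat.eq_zero_or_pos g with rfl | hg
  · simp
  have hg' : (0:ℝ) < g := by exact_mod_cast hg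
  have h := pow_sum_aux β h0 h1 g
  have : ∑ l ∈ Finset.Icc 1 g, ((g:ℝ) / l) ^ β = (g:ℝ)^β * ∑ l ∈ Finset.Icc 1 g, (l:ℝ) ^ (-β) := by
    rw [Finset.mul_sum]
    refine Finset.sum_congr rfl fun l _ => ?_
    rw [Real.div_rpow hg'.le (by positivity), Real.rpow_neg (by positivity)]
    rfl
  rw [this]
  calc _ ≤ (g:ℝ)^β * ((g:ℝ) ^ (1 - β) / (1 - β)) := mul_le_mul_of_nonneg_left h (by positivity)
    _ = ((g:ℝ)^β * (g:ℝ) ^ (1 - β)) / (1 - β) := by ring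
    _ = _ := by rw [← Real.rpow_add hg']; simp; ring

/-- gcd of a residue with the modulus -/
def gc {m : ℕ} (x : ZMod m) : ℕ := Nat.gcd x.val m

lemma gc_pos {m : ℕ} [NeZero m] (x : ZMod m) : 0 < gc x :=
  Nat.gcd_pos_of_pos_right _ (Nat.pos_of_ne_zero (NeZero.ne m))

lemma gc_dvd {m : ℕ} [NeZero m] (x y : ZMod m) : (gc x : ℤ) ∣ (x * y).valMinAbs := by
  have h1 : (gc x : ℤ) ∣ m := by exact_mod_cast Nat.gcd_dvd_right _ _
  have h2 : (gc x : ℤ) ∣ x.val := by exact_mod_cast Nat.gcd_dvd_left _ _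
  have h3 : (m : ℤ) ∣ (x.val * y.val : ℤ) - (x*y).valMinAbs := by
    rw [← ZMod.intCast_eq_intCast_iff_dvd_sub]
    simp
  have h4 := (Dvd.dvd.mul_right h2 (y.val : ℤ)).sub (h1.trans h3)
  simpa using h4

lemma mul_cancel_mod {m : ℕ} [NeZero m] (x y z : ZMod m) (h : x * y = x * z) :
    y.val ≡ z.val [MOD (m / gc x)] := by
  have h1 : x.val * y.val ≡ x.val * z.val [MOD m] := by
    rw [← ZMod.natCast_eq_natCast_iff]
    simpa using h
  have := Nat.ModEq.cancel_left_div_gcd (Nat.pos_of_ne_zero (NeZero.ne m)) h1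
  rwa [Nat.gcd_comm] at this

lemma fib_card {m : ℕ} [NeZero m] (x e : ZMod m) (S : Finset (ZMod m)) :
    (S.filter (fun y => x * y = e)).card ≤ gc x := by
  have hm : 0 < m := Nat.pos_of_ne_zero (NeZero.ne m)
  have hdvd : gc x ∣ m := Nat.gcd_dvd_right _ _
  have hmg : m / gc x * gc x = m := Nat.div_mul_cancel hdvd
  have hq : 0 < m / gc x := Nat.div_pos (Nat.le_of_dvd hm hdvd) (gc_pos x)
  calc _ ≤ (Finset.range (gc x)).card := by
        refine Finset.card_le_card_of_injOn (fun y => y.val / (m / gc x)) ?_ ?_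
        · intro y _
          simp only [Finset.coe_range, Set.mem_Iio]
          rw [Nat.div_lt_iff_lt_mul hq, mul_comm, hmg]
          exact y.val_lt
        · intro y hy z hz hyz
          simp only [Finset.coe_filter, Set.mem_ofPred_eq] at hy hz
          have h1 := mul_cancel_mod x y z (hy.2.trans hz.2.symm)
          apply ZMod.val_injective m
          rw [← Nat.div_add_mod y.val (m / gc x), ← Nat.div_add_mod z.val (m / gc x)]
          have h2 : y.val % (m / gc x) = z.val % (m / gc x) := h1
          simp only at hyz
          rw [hyz, h2]
    _ = gc x := by simp

lemma count_nonzero {m : ℕ} [NeZero m] (x : ZMod m) (R : ℕ) :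
    (Finset.univ.filter (fun y : ZMod m => x * y ≠ 0 ∧ nrm (x * y) ≤ R)).card ≤ 2 * R := by
  set S := Finset.univ.filter (fun y : ZMod m => x * y ≠ 0 ∧ nrm (x * y) ≤ R) with hS
  have h1 := Finset.card_le_mul_card_image (f := fun y => x * y) S (gc x)
    (fun e _ => fib_card x e S)
  have hg := gc_pos x
  have h2 : (S.image (fun y => x * y)).card ≤ 2 * (R / gc x) := by
    calc _ ≤ ((Finset.Icc (-((R / gc x : ℕ):ℤ)) ((R / gc x : ℕ):ℤ)).erase 0).card := by
          refine Finset.card_le_card_of_injOn (fun e => e.valMinAbs / (gc x : ℤ)) ?_ ?_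
          · intro e he
            simp only [Finset.coe_image, Set.mem_image, Finset.mem_coe, hS, Finset.mem_filter] at he
            obtain ⟨y, ⟨_, hy1, hy2⟩, rfl⟩ := he
            obtain ⟨k, hk⟩ := gc_dvd x y
            have hk0 : k ≠ 0 := by
              rintro rfl
              rw [mul_zero, ZMod.valMinAbs_eq_zero] at hk
              exact hy1 hk
            simp only [Finset.coe_erase, Set.mem_sdiff]
            rw [hk, Int.mul_ediv_cancel_left _ (by exact_mod_cast hg.ne')]
            rw [nrm, hk, Int.natAbs_mul, Int.natAbs_natCast] at hy2
            have : k.natAbs ≤ R / gc x := by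
              rw [Nat.le_div_iff_mul_le hg, mul_comm]; exact hy2
            simp only [Finset.coe_Icc, Set.mem_Icc, Set.mem_singleton_iff]
            refine ⟨⟨?_, ?_⟩, hk0⟩ <;> omega
          · intro e he f hf hef
            simp only [Finset.coe_image, Set.mem_image, Finset.mem_coe] at he hf
            obtain ⟨y, _, rfl⟩ := he
            obtain ⟨z, _, rfl⟩ := hf
            simp only at hef
            apply ZMod.injective_valMinAbs
            rw [← Int.ediv_mul_cancel (gc_dvd x y), ← Int.ediv_mul_cancel (gc_dvd x z), hef]
      _ = 2 * (R / gc x) := by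
          generalize R / gc x = t
          rw [Finset.card_erase_of_mem (by rw [Finset.mem_Icc]; omega)]
          simp only [Int.card_Icc]
          omega
  calc S.card ≤ gc x * (2 * (R / gc x)) := h1.trans (Nat.mul_le_mul_left _ h2)
    _ = 2 * (R / gc x * gc x) := by ring
    _ ≤ 2 * R := Nat.mul_le_mul_left _ (Nat.div_mul_le_self _ _)

lemma cast_injOn {m : ℕ} [NeZero m] :
    Set.InjOn (fun a : ℕ => (a : ZMod m)) (Finset.Icc 1 m : Finset ℕ) := by
  intro a ha b hb h
  simp only [Finset.coe_Icc, Set.mem_Icc] at ha hb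
  simp only at h
  rw [ZMod.natCast_eq_natCast_iff] at h
  have h1 : a - 1 ≡ b - 1 [MOD m] := by
    apply Nat.ModEq.add_right_cancel' 1
    rwa [Nat.sub_add_cancel ha.1, Nat.sub_add_cancel hb.1]
  have := Nat.ModEq.eq_of_lt_of_lt h1 (by omega) (by omega)
  omega

lemma count_all {m : ℕ} [NeZero m] (h : ZMod m) (R : ℕ) (hR : gc h ≤ R) :
    ((Finset.Icc 1 m).filter (fun a : ℕ => nrm (h * (a : ZMod m)) ≤ R)).card ≤ 3 * R := by
  calc _ ≤ (Finset.univ.filter (fun y : ZMod m => h * y ≠ 0 ∧ nrm (h * y) ≤ R) ∪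
            Finset.univ.filter (fun y : ZMod m => h * y = 0)).card := by
        refine Finset.card_le_card_of_injOn (fun a : ℕ => (a : ZMod m)) ?_ ?_
        · intro a ha
          simp only [Finset.coe_filter, Set.mem_ofPred_eq] at ha
          by_cases h0 : h * (a : ZMod m) = 0 <;> simp [h0, ha.2]
        · refine cast_injOn.mono ?_
          intro a ha
          simp only [Finset.coe_filter, Set.mem_ofPred_eq] at ha
          exact ha.1
    _ ≤ 2 * R + gc h := (Finset.card_union_le _ _).trans
        (add_le_add (count_nonzero h R) (fib_card h 0 _))
    _ ≤ 3 * R := by omega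

lemma weight_zero (β : ℝ) (h0 : 0 ≤ β) (h1 : β < 1) {m : ℕ} [NeZero m] (h : ZMod m) :
    ∑ a ∈ (Finset.Icc 1 m).filter (fun a : ℕ => h * (a : ZMod m) = 0), ((m:ℝ) / a) ^ β
      ≤ 1 / (1 - β) * gc h := by
  have hm : 0 < m := Nat.pos_of_ne_zero (NeZero.ne m)
  have hdvd : gc h ∣ m := Nat.gcd_dvd_right _ _
  have hmg : m / gc h * gc h = m := Nat.div_mul_cancel hdvd
  have hq : 0 < m / gc h := Nat.div_pos (Nat.le_of_dvd hm hdvd) (gc_pos h)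
  have hq' : (0:ℝ) < (m / gc h : ℕ) := by exact_mod_cast hq
  refine le_trans ?_ (pow_sum β h0 h1 (gc h))
  calc _ ≤ ∑ a ∈ (Finset.Icc 1 (gc h)).image (fun l => m / gc h * l), ((m:ℝ) / a) ^ β := by
        refine Finset.sum_le_sum_of_subset_of_nonneg ?_ fun _ _ _ => by positivity
        intro a ha
        simp only [Finset.mem_filter, Finset.mem_Icc] at ha
        obtain ⟨⟨ha1, ha2⟩, ha3⟩ := ha
        have h2 : h.val * a ≡ h.val * 0 [MOD m] := by
          rw [← ZMod.natCast_eq_natCast_iff]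
          simpa using ha3
        have h3 := Nat.ModEq.cancel_left_div_gcd hm h2
        rw [Nat.gcd_comm, Nat.modEq_zero_iff_dvd] at h3
        obtain ⟨l, hl⟩ := h3
        change a = m / gc h * l at hl
        rw [Finset.mem_image]
        refine ⟨l, ?_, hl.symm⟩
        rw [Finset.mem_Icc]
        constructor
        · rcases Nat.eq_zero_or_pos l with rfl | h
          · simp at hl; omega
          · exact h
        · by_contra! hlt
          have : m / gc h * gc h < m / gc h * l := Nat.mul_lt_mul_of_pos_left hlt hq
          omega
    _ = ∑ l ∈ Finset.Icc 1 (gc h), ((gc h : ℝ) / l) ^ β := by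
        rw [Finset.sum_image (fun x _ y _ hxy => Nat.eq_of_mul_eq_mul_left hq hxy)]
        refine Finset.sum_congr rfl fun l _ => ?_
        congr 1
        have : (m:ℝ) = (m / gc h : ℕ) * (gc h : ℝ) := by exact_mod_cast hmg.symm
        rw [this]
        push_cast
        rw [mul_div_mul_left _ _ hq'.ne']
    _ ≤ _ := le_rfl

lemma weight_pairs (β : ℝ) (h0 : 0 ≤ β) (h1 : β < 1) {m : ℕ} [NeZero m] (R : ℕ) :
    ∑ h ∈ Finset.univ.filter (fun h : ZMod m => gc h ≤ R),
      ∑ a ∈ (Finset.Icc 1 m).filter (fun a : ℕ => nrm (h * (a : ZMod m)) ≤ R), ((m:ℝ) / a) ^ β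
      ≤ 3 * (1 / (1 - β)) * R * m := by
  have hC : 0 < 1 / (1 - β) := by apply div_pos one_pos; linarith
  set C := 1 / (1 - β) with hCdef
  have hsplit : ∀ h : ZMod m,
      ∑ a ∈ (Finset.Icc 1 m).filter (fun a : ℕ => nrm (h * (a : ZMod m)) ≤ R), ((m:ℝ) / a) ^ β
      ≤ ∑ a ∈ (Finset.Icc 1 m).filter (fun a : ℕ => h * (a : ZMod m) = 0), ((m:ℝ) / a) ^ β
       + ∑ a ∈ (Finset.Icc 1 m), if (a : ZMod m) * h ≠ 0 ∧ nrm ((a : ZMod m) * h) ≤ R then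
          ((m:ℝ) / a) ^ β else 0 := by
    intro h
    rw [Finset.sum_filter, Finset.sum_filter, ← Finset.sum_add_distrib]
    refine Finset.sum_le_sum fun a _ => ?_
    have : 0 ≤ ((m:ℝ) / a) ^ β := by positivity
    rw [mul_comm (a : ZMod m) h]
    by_cases e1 : h * (a : ZMod m) = 0 <;> by_cases e2 : nrm (h * (a : ZMod m)) ≤ R
    all_goals simp only [e1, e2, if_true, if_false, ne_eq, not_true, not_false_iff, true_and,
      and_true, false_and, and_false]
    all_goals first | linarith | (split_ifs <;> linarith)
  refine (Finset.sum_le_sum fun h _ => hsplit h).trans ?_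
  rw [Finset.sum_add_distrib]
  have hA : ∑ h ∈ Finset.univ.filter (fun h : ZMod m => gc h ≤ R),
      ∑ a ∈ (Finset.Icc 1 m).filter (fun a : ℕ => h * (a : ZMod m) = 0), ((m:ℝ) / a) ^ β
      ≤ m * (C * R) := by
    calc _ ≤ ∑ h ∈ Finset.univ.filter (fun h : ZMod m => gc h ≤ R), (C * R) := by
          refine Finset.sum_le_sum fun h hh => (weight_zero β h0 h1 h).trans ?_
          have : (gc h : ℝ) ≤ R := by exact_mod_cast (Finset.mem_filter.1 hh).2
          exact mul_le_mul_of_nonneg_left this hC.le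
      _ = ((Finset.univ.filter (fun h : ZMod m => gc h ≤ R)).card : ℝ) * (C * R) := by
          rw [Finset.sum_const, nsmul_eq_mul]
      _ ≤ _ := by
          refine mul_le_mul_of_nonneg_right ?_ (by positivity)
          have := Finset.card_filter_le (Finset.univ : Finset (ZMod m)) (fun h => gc h ≤ R)
          rw [Finset.card_univ, ZMod.card] at this
          exact_mod_cast this
  have hB : ∑ h ∈ Finset.univ.filter (fun h : ZMod m => gc h ≤ R),
      ∑ a ∈ (Finset.Icc 1 m), (if (a : ZMod m) * h ≠ 0 ∧ nrm ((a : ZMod m) * h) ≤ R then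
          ((m:ℝ) / a) ^ β else 0) ≤ (2 * R) * (C * m) := by
    rw [Finset.sum_comm]
    calc _ ≤ ∑ a ∈ Finset.Icc 1 m, (2 * R) * ((m:ℝ) / a) ^ β := by
          refine Finset.sum_le_sum fun a _ => ?_
          rw [← Finset.sum_filter, Finset.sum_const, nsmul_eq_mul]
          refine mul_le_mul_of_nonneg_right ?_ (by positivity)
          have h2 := count_nonzero (a : ZMod m) R
          have h3 : ((Finset.univ.filter (fun y : ZMod m =>
            (a : ZMod m) * y ≠ 0 ∧ nrm ((a : ZMod m) * y) ≤ R)).card : ℝ) ≤ 2 * R := by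
            exact_mod_cast h2
          refine le_trans ?_ h3
          rw [Nat.cast_le]
          refine Finset.card_le_card ?_
          intro y hy
          simp only [Finset.mem_filter] at hy ⊢
          exact ⟨Finset.mem_univ _, hy.2⟩
      _ = (2 * R) * ∑ a ∈ Finset.Icc 1 m, ((m:ℝ) / a) ^ β := by rw [Finset.mul_sum]
      _ ≤ _ := mul_le_mul_of_nonneg_left (pow_sum β h0 h1 m) (by positivity)
  linarith

/-- short dual vector -/
def Bad {n : ℕ} (m R : ℕ) (a : Fin n → ℕ) : Prop :=
  ∃ h : ZMod m, h ≠ 0 ∧ ∀ i, nrm (h * (a i : ZMod m)) ≤ R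

lemma gc_le_of_bad {n m : ℕ} [NeZero m] (a : Fin n → ℕ) (ha : Finset.univ.gcd a = 1) (R : ℕ)
    (h : ZMod m) (h0 : h ≠ 0) (hh : ∀ i, nrm (h * (a i : ZMod m)) ≤ R) : gc h ≤ R := by
  by_contra! hlt
  apply h0
  have h1 : ∀ i, m ∣ h.val * a i := by
    intro i
    have h2 := gc_dvd h (a i : ZMod m)
    have h3 := hh i
    have h4 : (h * (a i : ZMod m)).valMinAbs = 0 := by
      apply Int.eq_zero_of_dvd_of_natAbs_lt_natAbs h2
      simp only [Int.natAbs_natCast]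
      exact lt_of_le_of_lt h3 hlt
    rw [ZMod.valMinAbs_eq_zero] at h4
    rw [← ZMod.natCast_eq_zero_iff]
    simpa using h4
  have h5 : m ∣ Finset.univ.gcd (fun i => h.val * a i) := Finset.dvd_gcd fun i _ => h1 i
  rw [Finset.gcd_mul_left, ha] at h5
  simp only [normalize_eq, mul_one] at h5
  have := Nat.eq_zero_of_dvd_of_lt h5 h.val_lt
  rwa [ZMod.val_eq_zero] at this

open Classical in
/-- vectors with maximal entry `m` at `p` -/
noncomputable def vecs (n m : ℕ) (p : Fin n) : Finset (Fin n → ℕ) :=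
  (Fintype.piFinset (fun i => if i = p then {m} else Finset.Icc 1 m)).filter
    (fun a => Finset.univ.gcd a = 1)

lemma prod_pq {n : ℕ} (p q : Fin n) (hpq : p ≠ q) (x y : ℝ) :
    ∏ i, (if i = p then 1 else if i = q then x else y) = x * y ^ (n - 2) := by
  rw [← Finset.mul_prod_erase _ _ (Finset.mem_univ p),
    ← Finset.mul_prod_erase _ _ (Finset.mem_erase.2 ⟨hpq.symm, Finset.mem_univ q⟩)]
  rw [Finset.prod_congr rfl (g := fun _ => y)]
  · simp [hpq.symm]
    left
    rw [Nat.sub_sub]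
  · intro i hi
    simp only [Finset.mem_erase] at hi
    simp [hi.1, hi.2.1]

lemma sum_biUnion_le' {ι κ : Type*} [DecidableEq κ] (s : Finset ι) (t : ι → Finset κ)
    (f : κ → ℝ) (hf : ∀ x, 0 ≤ f x) : ∑ x ∈ s.biUnion t, f x ≤ ∑ i ∈ s, ∑ x ∈ t i, f x := by
  classical
  induction s using Finset.induction_on with
  | empty => simp
  | insert i s hi ih =>
    rw [Finset.biUnion_insert, Finset.sum_insert hi]
    have := Finset.sum_union_inter (s₁ := t i) (s₂ := s.biUnion t) (f := f)
    have h2 : 0 ≤ ∑ x ∈ t i ∩ s.biUnion t, f x := Finset.sum_nonneg fun x _ => hf x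
    linarith

open Classical in
lemma bad_count (β : ℝ) (h0 : 0 ≤ β) (h1 : β < 1) {n m : ℕ} [NeZero m] (p q : Fin n) (hpq : p ≠ q)
    (R : ℕ) : ∑ a ∈ (vecs n m p).filter (fun a => Bad m R a), ((m:ℝ) / a q) ^ β
      ≤ 3 * (1 / (1 - β)) * R * m * (3 * R) ^ (n - 2) := by
  let f : Fin n → ℕ → ℝ := fun i x => if i = q then ((m:ℝ) / x) ^ β else 1
  have hf : ∀ i x, 0 ≤ f i x := by intro i x; simp only [f]; split_ifs <;> positivity
  let S : ZMod m → Fin n → Finset ℕ := fun h i => if i = p then {m} else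
    (Finset.Icc 1 m).filter (fun x : ℕ => nrm (h * (x : ZMod m)) ≤ R)
  have hfa : ∀ a : Fin n → ℕ, ((m:ℝ) / a q) ^ β = ∏ i, f i (a i) := by
    intro a
    simp [f]
  calc _ ≤ ∑ a ∈ (Finset.univ.filter (fun h : ZMod m => gc h ≤ R)).biUnion
            (fun h => Fintype.piFinset (S h)), ((m:ℝ) / a q) ^ β := by
        refine Finset.sum_le_sum_of_subset_of_nonneg ?_ fun _ _ _ => by positivity
        intro a ha
        simp only [vecs, Finset.mem_filter, Fintype.mem_piFinset] at ha
        obtain ⟨⟨ha1, ha2⟩, h, hne, hh⟩ := ha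
        rw [Finset.mem_biUnion]
        refine ⟨h, ?_, ?_⟩
        · simp only [Finset.mem_filter, Finset.mem_univ, true_and]
          exact gc_le_of_bad a ha2 R h hne hh
        · rw [Fintype.mem_piFinset]
          intro i
          have := ha1 i
          simp only [S]
          split_ifs with hi
          · simpa [hi] using this
          · simp only [hi, if_false] at this
            exact Finset.mem_filter.2 ⟨this, hh i⟩
    _ ≤ ∑ h ∈ Finset.univ.filter (fun h : ZMod m => gc h ≤ R),
          ∑ a ∈ Fintype.piFinset (S h), ((m:ℝ) / a q) ^ β := by
        exact sum_biUnion_le' _ _ _ (fun a => by positivity)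
    _ ≤ ∑ h ∈ Finset.univ.filter (fun h : ZMod m => gc h ≤ R),
          (∑ x ∈ (Finset.Icc 1 m).filter (fun x : ℕ => nrm (h * (x : ZMod m)) ≤ R),
            ((m:ℝ) / x) ^ β) * (3 * R) ^ (n - 2) := by
        refine Finset.sum_le_sum fun h hh => ?_
        simp_rw [hfa]
        rw [← Finset.prod_univ_sum, ← prod_pq p q hpq]
        refine Finset.prod_le_prod (fun i _ => Finset.sum_nonneg fun x _ => hf i x) ?_
        intro i _
        by_cases hip : i = p
        · subst hip
          simp [S, f, hpq]
        · by_cases hiq : i = q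
          · simp [S, f, hiq, hpq.symm]
          · simp only [S, f, hip, hiq, if_false, Finset.sum_const, nsmul_eq_mul, mul_one]
            have := count_all h R (Finset.mem_filter.1 hh).2
            exact_mod_cast this
    _ ≤ _ := by
        rw [← Finset.sum_mul]
        exact mul_le_mul_of_nonneg_right (weight_pairs β h0 h1 R) (by positivity)

lemma total_count (β : ℝ) (h0 : 0 ≤ β) (h1 : β < 1) {n m : ℕ} (p q : Fin n) (hpq : p ≠ q) :
    ∑ a ∈ vecs n m p, ((m:ℝ) / a q) ^ β ≤ (1 / (1 - β)) * m * m ^ (n - 2) := by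
  classical
  let f : Fin n → ℕ → ℝ := fun i x => if i = q then ((m:ℝ) / x) ^ β else 1
  have hf : ∀ i x, 0 ≤ f i x := by intro i x; simp only [f]; split_ifs <;> positivity
  have hfa : ∀ a : Fin n → ℕ, ((m:ℝ) / a q) ^ β = ∏ i, f i (a i) := by
    intro a
    simp [f]
  calc _ ≤ ∑ a ∈ Fintype.piFinset (fun i => if i = p then {m} else Finset.Icc 1 m),
            ((m:ℝ) / a q) ^ β := by
        refine Finset.sum_le_sum_of_subset_of_nonneg ?_ fun _ _ _ => by positivity
        unfold vecs
        convert Finset.filter_subset _ _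
    _ = ∏ i, (if i = p then 1 else if i = q then ∑ x ∈ Finset.Icc 1 m, ((m:ℝ) / x) ^ β
            else (m:ℝ)) := by
        simp_rw [hfa]
        rw [← Finset.prod_univ_sum]
        refine Finset.prod_congr rfl fun i _ => ?_
        by_cases hip : i = p
        · subst hip
          simp [f, hpq]
        · by_cases hiq : i = q
          · simp [f, hiq, hpq.symm]
          · simp [f, hip, hiq]
    _ ≤ _ := by
        rw [prod_pq p q hpq]
        exact mul_le_mul_of_nonneg_right (pow_sum β h0 h1 m) (by positivity)
lemma sols_finite {n : ℕ} (a : Fin n → ℕ) (ha : ∀ i, 0 < a i) (b : ℤ) :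
    {z : Fin n → ℕ | ∑ i, (a i : ℤ) * (z i : ℤ) = b}.Finite := by
  refine (Set.finite_Iic (fun _ : Fin n => b.toNat)).subset ?_
  intro z hz
  rw [Set.mem_Iic, Pi.le_def]
  intro i
  have hz' : ∑ i, (a i : ℤ) * (z i : ℤ) = b := hz
  have h1 : (a i : ℤ) * (z i : ℤ) ≤ ∑ i, (a i : ℤ) * (z i : ℤ) :=
    Finset.single_le_sum (f := fun i => (a i : ℤ) * (z i : ℤ)) (fun j _ => by positivity)
      (Finset.mem_univ i)
  have h2 : (1:ℤ) ≤ a i := by exact_mod_cast ha i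
  have h3 : (z i : ℤ) ≤ (a i : ℤ) * z i := by nlinarith [(Int.natCast_nonneg (z i))]
  omega

lemma count_reps {n : ℕ} (a : Fin n → ℕ) (ha : ∀ i, 0 < a i) (p : Fin n) (L σ s : ℕ)
    (hL : 1 ≤ L) (hs : s ≤ σ ^ (n - 1))
    (hcov : ∀ r : ZMod (a p), ∃ z : Fin n → ℕ, (∀ i, z i < L) ∧
      ∑ i, (a i : ZMod (a p)) * (z i : ZMod (a p)) = r)
    (b : ℤ) (hb : (L:ℤ) * σ * ∑ i ∈ Finset.univ.erase p, (a i : ℤ) ≤ b) :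
    s ≤ {z : Fin n → ℕ | ∑ i, (a i : ℤ) * (z i : ℤ) = b}.ncard := by
  have hex : ∀ u : {i : Fin n // i ≠ p} → Fin σ, ∃ x : Fin n → ℕ,
      ∑ i, (a i : ℤ) * (x i : ℤ) = b ∧ ∀ i : {i : Fin n // i ≠ p}, x i / L = u i := by
    intro u
    let v : Fin n → ℕ := fun i => if h : i ≠ p then (u ⟨i, h⟩ : ℕ) else 0
    have hv : ∀ i ∈ Finset.univ.erase p, v i + 1 ≤ σ := by
      intro i hi
      have hi' := Finset.ne_of_mem_erase hi
      simp only [v, hi', ne_eq, not_false_iff, dif_pos]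
      exact (u ⟨i, hi'⟩).2
    obtain ⟨z, hz1, hz2⟩ := hcov ((b : ZMod (a p)) -
      ∑ i ∈ Finset.univ.erase p, (a i : ZMod (a p)) * ((L * v i : ℕ) : ZMod (a p)))
    let T : ℤ := ∑ i ∈ Finset.univ.erase p, (a i : ℤ) * ((L * v i + z i : ℕ) : ℤ)
    have hT : T ≤ b := by
      refine le_trans ?_ hb
      rw [Finset.mul_sum]
      refine Finset.sum_le_sum fun i hi => ?_
      have h1 : L * v i + z i ≤ L * σ := by
        have := Nat.mul_le_mul_left L (hv i hi)
        have := hz1 i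
        rw [mul_add] at *
        omega
      have h2 : ((L * v i + z i : ℕ) : ℤ) ≤ (L:ℤ) * σ := by exact_mod_cast h1
      rw [mul_comm]
      exact mul_le_mul_of_nonneg_right h2 (by positivity)
    have hdvd : (a p : ℤ) ∣ b - T := by
      rw [← ZMod.intCast_eq_intCast_iff_dvd_sub]
      rw [← Finset.add_sum_erase _ _ (Finset.mem_univ p)] at hz2
      have h1 : ((T : ℤ) : ZMod (a p)) = ∑ i ∈ Finset.univ.erase p, (a i : ZMod (a p)) *
          (z i : ZMod (a p)) + ∑ i ∈ Finset.univ.erase p, (a i : ZMod (a p)) *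
          ((L * v i : ℕ) : ZMod (a p)) := by
        rw [← Finset.sum_add_distrib]
        simp only [T]
        push_cast
        refine Finset.sum_congr rfl fun i _ => ?_
        ring
      rw [h1]
      simp only [ZMod.natCast_self, zero_mul, zero_add] at hz2
      rw [hz2]
      ring
    obtain ⟨k, hk⟩ := hdvd
    have hap : (0:ℤ) < a p := by exact_mod_cast ha p
    have hk0 : 0 ≤ k := by
      by_contra! h
      nlinarith
    refine ⟨fun i => if i = p then k.toNat else L * v i + z i, ?_, ?_⟩
    · rw [← Finset.add_sum_erase _ _ (Finset.mem_univ p)]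
      have : ∑ i ∈ Finset.univ.erase p,
          (a i : ℤ) * ((if i = p then k.toNat else L * v i + z i : ℕ) : ℤ) = T := by
        refine Finset.sum_congr rfl fun i hi => ?_
        rw [if_neg (Finset.ne_of_mem_erase hi)]
      rw [this]
      simp only [if_true]
      rw [Int.toNat_of_nonneg hk0]
      linarith
    · rintro ⟨i, hi⟩
      simp only [hi, if_false, v, ne_eq, not_false_iff, dif_pos]
      rw [Nat.mul_add_div (by omega), Nat.div_eq_of_lt (hz1 i), add_zero]
  choose x hx1 hx2 using hex
  have hinj : Function.Injective x := by
    intro u u' h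
    funext i
    apply Fin.ext
    rw [← hx2 u i, ← hx2 u' i, h]
  calc s ≤ σ ^ (n - 1) := hs
    _ = (Set.range x).ncard := by
        rw [← Set.image_univ, Set.ncard_image_of_injective _ hinj, Set.ncard_univ,
          Nat.card_eq_fintype_card]
        simp
    _ ≤ _ := by
        refine Set.ncard_le_ncard ?_ (sols_finite a ha b)
        rintro _ ⟨u, rfl⟩
        exact hx1 u

lemma weight_ineq {n : ℕ} (hn : 3 ≤ n) (a : Fin n → ℕ) (ha : ∀ i, 0 < a i) (p q : Fin n)
    (hp : ∀ i, a i ≤ a p) (hq : ∀ i, i ≠ p → a q ≤ a i) (i : Fin n) (hi : i ≠ p)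
    (d β : ℝ) (hd : d = (n:ℝ) - 1) (hβ : β = 1 - 1 / d) :
    (a i : ℝ) ≤ (∏ j ∈ Finset.univ.erase p, (a j : ℝ)) ^ (1 / d) * ((a p : ℝ) / a q) ^ β := by
  have hn' : (3:ℝ) ≤ n := by exact_mod_cast hn
  have hd2 : 2 ≤ d := by linarith
  have hai : (0:ℝ) < a i := by exact_mod_cast ha i
  have haq : (0:ℝ) < a q := by exact_mod_cast ha q
  have hap : (0:ℝ) < a p := by exact_mod_cast ha p
  have hβ0 : 0 ≤ β := by
    rw [hβ, sub_nonneg, div_le_one (by linarith)]; linarith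
  have h1 : (a i : ℝ) * (a q : ℝ) ^ (n - 2) ≤ ∏ j ∈ Finset.univ.erase p, (a j : ℝ) := by
    have hmem : i ∈ Finset.univ.erase p := Finset.mem_erase.2 ⟨hi, Finset.mem_univ i⟩
    rw [← Finset.mul_prod_erase _ _ hmem]
    refine mul_le_mul_of_nonneg_left ?_ hai.le
    calc (a q : ℝ) ^ (n - 2) = ∏ j ∈ (Finset.univ.erase p).erase i, (a q : ℝ) := by
          rw [Finset.prod_const, Finset.card_erase_of_mem hmem,
            Finset.card_erase_of_mem (Finset.mem_univ p)]
          simp [Nat.sub_sub]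
      _ ≤ _ := by
          refine Finset.prod_le_prod (fun _ _ => haq.le) fun j hj => ?_
          simp only [Finset.mem_erase] at hj
          exact_mod_cast hq j hj.2.1
  have h2 : (a i : ℝ) ^ (1/d) * (a q : ℝ) ^ β ≤
      (∏ j ∈ Finset.univ.erase p, (a j : ℝ)) ^ (1 / d) := by
    refine le_trans (le_of_eq ?_) (Real.rpow_le_rpow (by positivity) h1 (by positivity))
    rw [Real.mul_rpow hai.le (by positivity), ← Real.rpow_natCast, ← Real.rpow_mul haq.le]
    congr 2
    rw [Nat.cast_sub (by omega), hβ]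
    field_simp
    rw [hd]
    push_cast
    ring
  have h3 : (a i : ℝ) = (a i : ℝ) ^ (1/d) * (a i : ℝ) ^ β := by
    rw [← Real.rpow_add hai, hβ]; simp
  have h4 : (a i : ℝ) ^ β ≤ (a q : ℝ) ^ β * ((a p : ℝ) / a q) ^ β := by
    rw [← Real.mul_rpow haq.le (by positivity), mul_div_cancel₀ _ haq.ne']
    exact Real.rpow_le_rpow hai.le (by exact_mod_cast hp i) hβ0
  calc (a i : ℝ) = (a i : ℝ) ^ (1/d) * (a i : ℝ) ^ β := h3
    _ ≤ (a i : ℝ) ^ (1/d) * ((a q : ℝ) ^ β * ((a p : ℝ) / a q) ^ β) :=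
        mul_le_mul_of_nonneg_left h4 (by positivity)
    _ = (a i : ℝ) ^ (1/d) * (a q : ℝ) ^ β * ((a p : ℝ) / a q) ^ β := by ring
    _ ≤ _ := mul_le_mul_of_nonneg_right h2 (by positivity)

lemma X_bound {n : ℕ} (hn : 3 ≤ n) (d β : ℝ) (hd : d = (n:ℝ) - 1) (hβ : β = 1 - 1 / d) :
    ∃ C : ℝ, 0 < C ∧ ∀ (a : Fin n → ℕ) (s : ℕ) (F : ℤ) (p q : Fin n) (ρ : ℕ), (∀ i, 0 < a i) →
      1 ≤ s → {z : Fin n → ℕ | ∑ i, (a i : ℤ) * (z i : ℤ) = F}.ncard < s →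
      (∀ i, a i ≤ a p) → (∀ i, i ≠ p → a q ≤ a i) → 1 ≤ ρ → ρ ≤ a p → ¬ Bad (a p) (ρ - 1) a →
      (F : ℝ) / ((s : ℝ) * ∏ i, (a i : ℝ)) ^ (1 / d) ≤
        C * (((a p : ℝ) / a q) ^ β * ((a p : ℝ) ^ β / ρ)) := by
  obtain ⟨K, hK, hcov⟩ := fourier_cover n
  have hn' : (3:ℝ) ≤ n := by exact_mod_cast hn
  have hd2 : 2 ≤ d := by linarith
  have hKr : (1:ℝ) ≤ K := by exact_mod_cast hK
  refine ⟨16 * K * n, by positivity, ?_⟩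
  intro a s F p q ρ ha hs hF hp hq hρ hρm hbad
  have hap := ha p
  have hapr : (0:ℝ) < a p := by exact_mod_cast hap
  have haqr : (0:ℝ) < a q := by exact_mod_cast ha q
  have hρr : (0:ℝ) < ρ := by exact_mod_cast hρ
  have hsr : (1:ℝ) ≤ s := by exact_mod_cast hs
  have : NeZero (a p) := ⟨hap.ne'⟩
  set N : ℕ := ⌈(K * a p : ℝ) / ρ⌉₊ with hN
  set σ : ℕ := ⌈(s:ℝ) ^ (1 / d)⌉₊ with hσ
  have hx1 : (1:ℝ) ≤ (K * a p : ℝ) / ρ := by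
    rw [le_div_iff₀ hρr]
    have : (ρ:ℝ) ≤ a p := by exact_mod_cast hρm
    nlinarith
  have hN1 : 1 ≤ N := by rw [hN, Nat.one_le_ceil_iff]; linarith
  have hN2 : (N:ℝ) ≤ 2 * ((K * a p : ℝ) / ρ) := by
    have := Nat.ceil_lt_add_one (show 0 ≤ (K * a p : ℝ) / ρ by linarith)
    rw [← hN] at this
    linarith
  have hN3 : K * a p ≤ N * ρ := by
    have := Nat.le_ceil ((K * a p : ℝ) / ρ)
    rw [← hN, div_le_iff₀ hρr] at this
    exact_mod_cast this
  have hy1 : (1:ℝ) ≤ (s:ℝ) ^ (1 / d) := Real.one_le_rpow hsr (by positivity)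
  have hσ2 : (σ:ℝ) ≤ 2 * (s:ℝ) ^ (1 / d) := by
    have := Nat.ceil_lt_add_one (show 0 ≤ (s:ℝ) ^ (1 / d) by linarith)
    rw [← hσ] at this
    linarith
  have hσ3 : s ≤ σ ^ (n - 1) := by
    have h1 := Nat.le_ceil ((s:ℝ) ^ (1 / d))
    rw [← hσ] at h1
    have h2 := pow_le_pow_left₀ (by linarith) h1 (n - 1)
    rw [← Real.rpow_natCast, ← Real.rpow_mul (by linarith), Nat.cast_sub (by omega)] at h2
    have h3 : 1 / d * ((n:ℝ) - ((1:ℕ):ℝ)) = 1 := by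
      rw [hd]; push_cast
      rw [one_div, inv_mul_cancel₀ (by linarith)]
    rw [h3, Real.rpow_one] at h2
    exact_mod_cast h2
  have hgood : ∀ h : ZMod (a p), h ≠ 0 → ∃ i, ρ ≤ nrm (h * (a i : ZMod (a p))) := by
    intro h hne
    by_contra! hlt
    exact hbad ⟨h, hne, fun i => by have := hlt i; omega⟩
  have hres := hcov (a p) (fun i => (a i : ZMod (a p))) ρ N hρ hN1 hN3 hgood
  have hFlt : F < ((4 * N : ℕ):ℤ) * σ * ∑ i ∈ Finset.univ.erase p, (a i : ℤ) := by
    by_contra! hge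
    exact absurd (count_reps a ha p (4 * N) σ s (by omega) hσ3 hres F hge) (not_le.2 hF)
  have hFr : (F:ℝ) ≤ 4 * N * σ * ∑ i ∈ Finset.univ.erase p, (a i : ℝ) := by
    exact_mod_cast hFlt.le
  set P : ℝ := ∏ j ∈ Finset.univ.erase p, (a j : ℝ) with hP
  have hP0 : 0 < P := Finset.prod_pos fun j _ => by exact_mod_cast ha j
  set w : ℝ := ((a p : ℝ) / a q) ^ β with hw
  have hw0 : 0 ≤ w := by positivity
  have hsum : ∑ i ∈ Finset.univ.erase p, (a i : ℝ) ≤ n * (P ^ (1/d) * w) := by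
    calc _ ≤ ∑ i ∈ Finset.univ.erase p, (P ^ (1/d) * w) :=
          Finset.sum_le_sum fun i hi =>
            weight_ineq hn a ha p q hp hq i (Finset.ne_of_mem_erase hi) d β hd hβ
      _ ≤ ∑ i : Fin n, (P ^ (1/d) * w) :=
          Finset.sum_le_sum_of_subset_of_nonneg (Finset.erase_subset _ _)
            fun _ _ _ => by positivity
      _ = _ := by simp
  have hden : ((s : ℝ) * ∏ i, (a i : ℝ)) ^ (1 / d) =
      (s:ℝ) ^ (1/d) * ((a p : ℝ) ^ (1/d) * P ^ (1/d)) := by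
    rw [← Finset.mul_prod_erase _ _ (Finset.mem_univ p), Real.mul_rpow (by linarith) (by positivity),
      Real.mul_rpow hapr.le hP0.le]
  have hapβ : (a p : ℝ) ^ β * (a p : ℝ) ^ (1/d) = a p := by
    rw [← Real.rpow_add hapr, hβ]; simp
  rw [hden, div_le_iff₀ (by positivity)]
  calc (F:ℝ) ≤ 4 * N * σ * ∑ i ∈ Finset.univ.erase p, (a i : ℝ) := hFr
    _ ≤ 4 * (2 * ((K * a p : ℝ) / ρ)) * (2 * (s:ℝ) ^ (1 / d)) * (n * (P ^ (1/d) * w)) := by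
        gcongr
    _ = 16 * K * n * (w * ((a p : ℝ) / ρ)) * ((s:ℝ) ^ (1/d) * P ^ (1/d)) := by ring
    _ = 16 * K * n * (w * (((a p : ℝ) ^ β * (a p : ℝ) ^ (1/d)) / ρ)) *
          ((s:ℝ) ^ (1/d) * P ^ (1/d)) := by rw [hapβ]
    _ = _ := by ring
lemma telescope (ρ : ℕ) (hρ : 1 ≤ ρ) (M : ℕ) (hM : ρ ≤ M + 1) :
    1 / (ρ:ℝ) ≤ 1 / ((M:ℝ) + 1) + ∑ R ∈ Finset.Icc ρ M, 1 / (R:ℝ)^2 := by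
  have key : ∀ k : ℕ, 1 / (ρ:ℝ) ≤ 1 / ((ρ + k : ℕ):ℝ) + ∑ R ∈ Finset.Ico ρ (ρ + k), 1 / (R:ℝ)^2 := by
    intro k
    induction k with
    | zero => simp
    | succ k ih =>
      rw [← add_assoc, Finset.sum_Ico_succ_top (by omega)]
      refine ih.trans ?_
      have hx : (1:ℝ) ≤ ((ρ + k : ℕ):ℝ) := by exact_mod_cast (by omega : 1 ≤ ρ + k)
      rw [Nat.cast_add (ρ + k) 1, Nat.cast_one]
      set x : ℝ := ((ρ + k : ℕ):ℝ)
      have : 1 / x ≤ 1 / (x + 1) + 1 / x ^ 2 := by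
        rw [div_add_div _ _ (by positivity) (by positivity), div_le_div_iff₀ (by positivity) (by positivity)]
        nlinarith [mul_pos (show 0 < x by linarith) (show 0 < x by linarith)]
      linarith
  have h := key (M + 1 - ρ)
  rw [Nat.add_sub_cancel' hM] at h
  have e : Finset.Ico ρ (M + 1) = Finset.Icc ρ M := by ext x; simp
  rw [e] at h
  exact_mod_cast h

lemma Bad.mono {n m R R' : ℕ} {a : Fin n → ℕ} (h : Bad m R a) (hR : R ≤ R') : Bad m R' a := by
  obtain ⟨x, h0, h1⟩ := h
  exact ⟨x, h0, fun i => (h1 i).trans hR⟩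

open Classical in
/-- majorant -/
noncomputable def Y {n : ℕ} (β : ℝ) (m : ℕ) (a : Fin n → ℕ) : ℝ :=
  2 + (m:ℝ) ^ β * ∑ R ∈ Finset.Icc 1 ⌊(m:ℝ) ^ β⌋₊, if Bad m R a then 1 / (R:ℝ)^2 else 0

open Classical in
lemma Y_nonneg {n : ℕ} (β : ℝ) (m : ℕ) (a : Fin n → ℕ) : 0 ≤ Y β m a := by
  unfold Y
  have : 0 ≤ ∑ R ∈ Finset.Icc 1 ⌊(m:ℝ) ^ β⌋₊, if Bad m R a then 1 / (R:ℝ)^2 else 0 :=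
    Finset.sum_nonneg fun R _ => by split_ifs <;> positivity
  positivity

lemma exists_rho {n : ℕ} (β : ℝ) (h0 : 0 ≤ β) (h1 : β < 1) (m : ℕ) (hm : 1 ≤ m)
    (a : Fin n → ℕ) (hg : Finset.univ.gcd a = 1) :
    ∃ ρ : ℕ, 1 ≤ ρ ∧ ρ ≤ m ∧ ¬ Bad m (ρ - 1) a ∧ (m:ℝ)^β / ρ ≤ Y β m a := by
  classical
  have : NeZero m := ⟨by omega⟩
  have hmr : (1:ℝ) ≤ m := by exact_mod_cast hm
  have hx1 : (1:ℝ) ≤ (m:ℝ)^β := Real.one_le_rpow hmr h0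
  have hxm : (m:ℝ)^β ≤ m := by
    calc (m:ℝ)^β ≤ (m:ℝ)^(1:ℝ) := Real.rpow_le_rpow_of_exponent_le hmr h1.le
      _ = m := Real.rpow_one _
  set M := ⌊(m:ℝ) ^ β⌋₊ with hM
  have hM1 : 1 ≤ M := by rw [hM, Nat.one_le_floor_iff]; exact hx1
  have hMm : M ≤ m := by
    have := Nat.floor_le (show 0 ≤ (m:ℝ)^β by linarith)
    rw [← hM] at this
    exact_mod_cast this.trans hxm
  have hMlt : (m:ℝ)^β < M + 1 := Nat.lt_floor_add_one _
  have hbad0 : ¬ Bad m 0 a := by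
    rintro ⟨h, hne, hh⟩
    have := gc_le_of_bad a hg 0 h hne hh
    have := gc_pos h
    omega
  have hS : 0 ≤ ∑ R ∈ Finset.Icc 1 M, if Bad m R a then 1 / (R:ℝ)^2 else 0 :=
    Finset.sum_nonneg fun R _ => by split_ifs <;> positivity
  by_cases hex : ∃ R, R ≤ M ∧ Bad m R a
  · have hex' : ∃ R, Bad m R a := let ⟨R, _, h⟩ := hex; ⟨R, h⟩
    set ρ := Nat.find hex' with hρ
    have hρb : Bad m ρ a := Nat.find_spec hex'
    have hρ1 : 1 ≤ ρ := by
      rcases Nat.eq_zero_or_pos ρ with h | h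
      · rw [h] at hρb; exact absurd hρb hbad0
      · exact h
    have hρM : ρ ≤ M := by
      obtain ⟨R, hR, hb⟩ := hex
      exact (Nat.find_min' hex' hb).trans hR
    refine ⟨ρ, hρ1, hρM.trans hMm, Nat.find_min hex' (by omega), ?_⟩
    have ht := telescope ρ hρ1 M (by omega)
    have hsub : ∑ R ∈ Finset.Icc ρ M, 1 / (R:ℝ)^2 ≤
        ∑ R ∈ Finset.Icc 1 M, if Bad m R a then 1 / (R:ℝ)^2 else 0 := by
      calc _ = ∑ R ∈ Finset.Icc ρ M, if Bad m R a then 1 / (R:ℝ)^2 else 0 := by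
            refine Finset.sum_congr rfl fun R hR => ?_
            rw [if_pos (hρb.mono (Finset.mem_Icc.1 hR).1)]
        _ ≤ _ := Finset.sum_le_sum_of_subset_of_nonneg
            (Finset.Icc_subset_Icc_left hρ1) fun R _ _ => by split_ifs <;> positivity
    unfold Y
    rw [← hM]
    have h5 : (m:ℝ)^β * (1 / ((M:ℝ) + 1)) ≤ 1 := by
      rw [mul_one_div, div_le_one (by positivity)]; exact hMlt.le
    have h6 : (m:ℝ)^β * (1 / (ρ:ℝ)) ≤ (m:ℝ)^β * (1 / ((M:ℝ) + 1) +
        ∑ R ∈ Finset.Icc 1 M, if Bad m R a then 1 / (R:ℝ)^2 else 0) :=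
      mul_le_mul_of_nonneg_left (by linarith) (by linarith)
    rw [mul_one_div, mul_add] at h6
    linarith
  · push Not at hex
    refine ⟨M, hM1, hMm, hex _ (by omega), ?_⟩
    have hMr : (1:ℝ) ≤ M := by exact_mod_cast hM1
    have : (m:ℝ)^β / M ≤ 2 := by
      rw [div_le_iff₀ (by linarith)]; linarith
    unfold Y
    rw [← hM]
    have : 0 ≤ (m:ℝ)^β * ∑ R ∈ Finset.Icc 1 M, if Bad m R a then 1 / (R:ℝ)^2 else 0 :=
      mul_nonneg (by linarith) hS
    linarith

lemma Y_sum {n : ℕ} (hn : 3 ≤ n) (d β : ℝ) (hd : d = (n:ℝ) - 1) (hβ : β = 1 - 1 / d)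
    (h0 : 0 ≤ β) (h1 : β < 1) (p q : Fin n) (hpq : p ≠ q) (m : ℕ) (hm : 1 ≤ m) :
    ∑ a ∈ vecs n m p, ((m:ℝ) / a q) ^ β * Y β m a ≤
      ((1 / (1 - β)) * (2 + 3 ^ (n - 1))) * (m:ℝ) ^ (n - 1) := by
  classical
  have : NeZero m := ⟨by omega⟩
  have hmr : (1:ℝ) ≤ m := by exact_mod_cast hm
  have hx1 : (1:ℝ) ≤ (m:ℝ)^β := Real.one_le_rpow hmr h0
  have hC : 0 < 1 / (1 - β) := by apply div_pos one_pos; linarith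
  have hd0 : d ≠ 0 := by
    have : (3:ℝ) ≤ n := by exact_mod_cast hn
    rw [hd]; linarith
  have htot := total_count β h0 h1 (m := m) p q hpq
  have hbc := fun R => bad_count β h0 h1 (m := m) p q hpq R
  set C := 1 / (1 - β)
  set M := ⌊(m:ℝ) ^ β⌋₊ with hM
  have hMle : (M:ℝ) ≤ (m:ℝ)^β := Nat.floor_le (by linarith)
  have e1 : ∑ a ∈ vecs n m p, ((m:ℝ) / a q) ^ β * Y β m a =
      2 * ∑ a ∈ vecs n m p, ((m:ℝ) / a q) ^ β + (m:ℝ)^β * ∑ R ∈ Finset.Icc 1 M,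
        (1 / (R:ℝ)^2) * ∑ a ∈ (vecs n m p).filter (fun a => Bad m R a), ((m:ℝ) / a q) ^ β := by
    simp_rw [Finset.sum_filter, Finset.mul_sum]
    simp_rw [← Finset.mul_sum]
    simp_rw [Finset.mul_sum]
    rw [Finset.sum_comm, ← Finset.sum_add_distrib]
    refine Finset.sum_congr rfl fun a _ => ?_
    unfold Y
    rw [← hM, mul_add, Finset.mul_sum, Finset.mul_sum]
    congr 1
    · ring
    · refine Finset.sum_congr rfl fun R _ => ?_
      split_ifs
      · ring
      · simp
  rw [e1]
  have e2 : (m:ℝ) * (m:ℝ)^(n-2) = (m:ℝ)^(n-1) := by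
    rw [← pow_succ']; congr 1; omega
  have hB : ∑ R ∈ Finset.Icc 1 M, (1 / (R:ℝ)^2) *
      ∑ a ∈ (vecs n m p).filter (fun a => Bad m R a), ((m:ℝ) / a q) ^ β ≤
      C * 3 ^ (n-1) * m * ((m:ℝ)^β)^(n-2) := by
    calc _ ≤ ∑ R ∈ Finset.Icc 1 M, C * 3 ^ (n-1) * m * ((m:ℝ)^β)^(n-3) := by
          refine Finset.sum_le_sum fun R hR => ?_
          rw [Finset.mem_Icc] at hR
          have hR0 : (0:ℝ) < R := by exact_mod_cast hR.1
          have hRM : (R:ℝ) ≤ (m:ℝ)^β := le_trans (by exact_mod_cast hR.2) hMle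
          calc _ ≤ (1 / (R:ℝ)^2) * (3 * C * R * m * (3 * R) ^ (n - 2)) :=
                mul_le_mul_of_nonneg_left (hbc R) (by positivity)
            _ = C * 3 ^ (n-1) * m * (R:ℝ)^(n-3) := by
                obtain ⟨k, rfl⟩ : ∃ k, n = k + 3 := ⟨n - 3, by omega⟩
                simp only [show k + 3 - 2 = k + 1 by omega, show k + 3 - 1 = k + 2 by omega,
                  show k + 3 - 3 = k by omega]
                field_simp
                ring
            _ ≤ _ := by gcongr
      _ = M * (C * 3 ^ (n-1) * m * ((m:ℝ)^β)^(n-3)) := by simp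
      _ ≤ (m:ℝ)^β * (C * 3 ^ (n-1) * m * ((m:ℝ)^β)^(n-3)) := by gcongr
      _ = C * 3 ^ (n-1) * m * ((m:ℝ)^β)^(n-2) := by
          obtain ⟨k, rfl⟩ : ∃ k, n = k + 3 := ⟨n - 3, by omega⟩
          simp only [show k + 3 - 2 = k + 1 by omega, show k + 3 - 3 = k by omega]
          ring
  have e3 : (m:ℝ)^β * (m * ((m:ℝ)^β)^(n-2)) = (m:ℝ)^(n-1) := by
    have e4 : (m:ℝ)^β * (m * ((m:ℝ)^β)^(n-2)) = m * ((m:ℝ)^β)^(n-1) := by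
      obtain ⟨k, rfl⟩ : ∃ k, n = k + 3 := ⟨n - 3, by omega⟩
      simp only [show k + 3 - 2 = k + 1 by omega, show k + 3 - 1 = k + 2 by omega]
      ring
    rw [e4, ← Real.rpow_natCast ((m:ℝ)^β), ← Real.rpow_mul (by linarith), ← e2]
    congr 1
    rw [← Real.rpow_natCast]
    congr 1
    rw [Nat.cast_sub (by omega), Nat.cast_sub (by omega), hβ]
    have : (n:ℝ) = d + 1 := by rw [hd]; ring
    rw [this]
    push_cast
    field_simp
    ring
  have h7 : (m:ℝ)^β * ∑ R ∈ Finset.Icc 1 M, (1 / (R:ℝ)^2) *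
      ∑ a ∈ (vecs n m p).filter (fun a => Bad m R a), ((m:ℝ) / a q) ^ β ≤
      C * 3 ^ (n-1) * (m:ℝ)^(n-1) := by
    calc _ ≤ (m:ℝ)^β * (C * 3 ^ (n-1) * m * ((m:ℝ)^β)^(n-2)) :=
          mul_le_mul_of_nonneg_left hB (by linarith)
      _ = C * 3 ^ (n-1) * ((m:ℝ)^β * (m * ((m:ℝ)^β)^(n-2))) := by ring
      _ = _ := by rw [e3]
  have h8 : C * m * (m:ℝ)^(n-2) = C * (m:ℝ)^(n-1) := by rw [mul_assoc, e2]
  rw [h8] at htot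
  linarith

lemma card_lower {n : ℕ} (hn : 3 ≤ n) (M : ℕ) (G : Finset (Fin n → ℕ))
    (hG : ∀ a, a ∈ G ↔ ((∀ i, 1 ≤ a i ∧ a i ≤ M) ∧ Finset.univ.gcd a = 1)) :
    (M:ℝ) ^ n ≤ 2 * G.card := by
  classical
  let B : ℕ → Finset (Fin n → ℕ) := fun k =>
    Fintype.piFinset (fun _ => (Finset.Icc 1 (M / k)).image (fun l => k * l))
  have hcov : Fintype.piFinset (fun _ : Fin n => Finset.Icc 1 M) ⊆
      G ∪ (Finset.Icc 2 M).biUnion B := by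
    intro a ha
    simp only [Fintype.mem_piFinset, Finset.mem_Icc] at ha
    rw [Finset.mem_union]
    by_cases hg : Finset.univ.gcd a = 1
    · left; rw [hG]; exact ⟨ha, hg⟩
    · right
      rw [Finset.mem_biUnion]
      set k := Finset.univ.gcd a with hk
      have hkd : ∀ i, k ∣ a i := fun i => Finset.gcd_dvd (Finset.mem_univ i)
      let i0 : Fin n := ⟨0, by omega⟩
      have hk0 : 0 < k := Nat.pos_of_dvd_of_pos (hkd i0) (ha i0).1
      have hkM : k ≤ M := (Nat.le_of_dvd (ha i0).1 (hkd i0)).trans (ha i0).2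
      refine ⟨k, Finset.mem_Icc.2 ⟨by omega, hkM⟩, ?_⟩
      simp only [B, Fintype.mem_piFinset, Finset.mem_image, Finset.mem_Icc]
      intro i
      refine ⟨a i / k, ⟨Nat.div_pos (Nat.le_of_dvd (ha i).1 (hkd i)) hk0,
        Nat.div_le_div_right (ha i).2⟩, Nat.mul_div_cancel' (hkd i)⟩
  have h1 : M ^ n ≤ G.card + ∑ k ∈ Finset.Icc 2 M, (M / k) ^ n := by
    calc M ^ n = (Fintype.piFinset (fun _ : Fin n => Finset.Icc 1 M)).card := by simp
      _ ≤ _ := Finset.card_le_card hcov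
      _ ≤ _ := Finset.card_union_le _ _
      _ ≤ G.card + ∑ k ∈ Finset.Icc 2 M, (B k).card :=
          Nat.add_le_add_left Finset.card_biUnion_le _
      _ ≤ _ := by
          refine Nat.add_le_add_left (Finset.sum_le_sum fun k _ => ?_) _
          simp only [B, Fintype.card_piFinset, Finset.prod_const, Finset.card_univ,
            Fintype.card_fin]
          refine Nat.pow_le_pow_left (Finset.card_image_le.trans ?_) _
          simp
  have h2 : ∀ M' : ℕ, 1 ≤ M' → ∑ k ∈ Finset.Icc 2 M', 1 / (k:ℝ)^3 ≤ (1 - 1 / (M':ℝ)) / 2 := by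
    intro M' hM'
    induction M', hM' using Nat.le_induction with
    | base => simp
    | succ k hk ih =>
      rw [Finset.sum_Icc_succ_top (by omega)]
      have hkr : (1:ℝ) ≤ k := by exact_mod_cast hk
      have : 1 / ((k + 1 : ℕ):ℝ)^3 ≤ (1 / (k:ℝ) - 1 / ((k + 1 : ℕ):ℝ)) / 2 := by
        push_cast
        have e : (1 / (k:ℝ) - 1 / ((k:ℝ) + 1)) / 2 = 1 / (2 * k * (k + 1)) := by
          field_simp; ring
        rw [e]
        apply one_div_le_one_div_of_le (by positivity)
        nlinarith [mul_nonneg (show (0:ℝ) ≤ k by linarith) (show (0:ℝ) ≤ k by linarith), sq_nonneg ((k:ℝ)+1), mul_nonneg (sq_nonneg ((k:ℝ))) (show (0:ℝ) ≤ k by linarith)]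
      linarith
  have h3 : ∑ k ∈ Finset.Icc 2 M, 1 / (k:ℝ)^3 ≤ 1 / 2 := by
    rcases Nat.eq_zero_or_pos M with h | h
    · rw [h]; simp
    · have := h2 M h
      have h4 : 0 ≤ 1 / (M:ℝ) := by positivity
      linarith
  have h4 : ∑ k ∈ Finset.Icc 2 M, (((M / k : ℕ):ℝ)) ^ n ≤ (M:ℝ)^n * (1 / 2) := by
    calc _ ≤ ∑ k ∈ Finset.Icc 2 M, (M:ℝ)^n * (1 / (k:ℝ)^3) := by
          refine Finset.sum_le_sum fun k hk => ?_
          have hk1 : (1:ℝ) ≤ k := by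
            exact_mod_cast (by have := (Finset.mem_Icc.1 hk).1; omega : 1 ≤ k)
          calc (((M / k : ℕ):ℝ)) ^ n ≤ ((M:ℝ) / k) ^ n := by
                gcongr
                exact Nat.cast_div_le
            _ = (M:ℝ)^n * (1 / (k:ℝ)^n) := by rw [div_pow]; ring
            _ ≤ _ := by
                gcongr
      _ = (M:ℝ)^n * ∑ k ∈ Finset.Icc 2 M, 1 / (k:ℝ)^3 := by rw [Finset.mul_sum]
      _ ≤ _ := mul_le_mul_of_nonneg_left h3 (by positivity)
  have h5 : (M:ℝ)^n ≤ G.card + ∑ k ∈ Finset.Icc 2 M, (((M / k : ℕ):ℝ)) ^ n := by exact_mod_cast h1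
  linarith

end SFrob

/-- **Upper bound on the average normalized s-Frobenius number** (Corollary 1 ii),
upper estimate, in Aliev–Fukshansky–Henk). For `n ≥ 3` there is a constant
`c = c_n > 0` such that for every `s ≥ 1` and `T ≥ 1`, the average over
`G(T)` (primitive positive integer vectors with `max aᵢ ≤ T`) of the normalized
`s`-Frobenius number `X_s(a) = F_s(a)/(s·a₁⋯aₙ)^(1/(n-1))` is at most `c`. -/
theorem average_sFrobenius_upper_bound {n : ℕ} (hn : 3 ≤ n) :
    ∃ c : ℝ, 0 < c ∧
      ∀ F : (Fin n → ℕ) → ℕ → ℤ,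
        (∀ (a : Fin n → ℕ) (s : ℕ), (∀ i, 0 < a i) → Finset.univ.gcd a = 1 → 1 ≤ s →
          IsGreatest
            {b : ℤ | {z : Fin n → ℕ | ∑ i, (a i : ℤ) * (z i : ℤ) = b}.ncard < s}
            (F a s)) →
      ∀ s : ℕ, 1 ≤ s → ∀ T : ℝ, 1 ≤ T →
      ∀ G : Finset (Fin n → ℕ),
        (∀ a, a ∈ G ↔ ((∀ i, 0 < a i) ∧ Finset.univ.gcd a = 1 ∧ ∀ i, (a i : ℝ) ≤ T)) →
        (1 / (G.card : ℝ)) * ∑ a ∈ G,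
            (F a s : ℝ) / ((s : ℝ) * ∏ i, (a i : ℝ)) ^ ((1 : ℝ) / ((n : ℝ) - 1))
          ≤ c := by
  classical
  obtain ⟨d, hd⟩ : ∃ d : ℝ, d = (n:ℝ) - 1 := ⟨_, rfl⟩
  obtain ⟨β, hβ⟩ : ∃ β : ℝ, β = 1 - 1 / d := ⟨_, rfl⟩
  have hn' : (3:ℝ) ≤ n := by exact_mod_cast hn
  have hd2 : 2 ≤ d := by linarith
  have h0 : 0 ≤ β := by rw [hβ, sub_nonneg, div_le_one (by linarith)]; linarith
  have h1 : β < 1 := by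
    have : 0 < 1 / d := by positivity
    linarith
  obtain ⟨C, hC, hX⟩ := SFrob.X_bound hn d β hd hβ
  have hC1 : 0 < 1 / (1 - β) := by apply div_pos one_pos; linarith
  obtain ⟨C', hC'⟩ : ∃ C' : ℝ, C' = (1 / (1 - β)) * (2 + 3 ^ (n - 1)) := ⟨_, rfl⟩
  have hC'0 : 0 < C' := by rw [hC']; positivity
  refine ⟨2 * ((n:ℝ) * n * C * C'), by positivity, ?_⟩
  intro F hF s hs T hT G hG
  rw [← hd]
  set M := ⌊T⌋₊ with hM
  have hT0 : 0 ≤ T := by linarith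
  have hG' : ∀ a, a ∈ G ↔ ((∀ i, 1 ≤ a i ∧ a i ≤ M) ∧ Finset.univ.gcd a = 1) := by
    intro a
    rw [hG]
    constructor
    · rintro ⟨e1, e2, e3⟩
      exact ⟨fun i => ⟨e1 i, Nat.le_floor (e3 i)⟩, e2⟩
    · rintro ⟨e1, e2⟩
      exact ⟨fun i => (e1 i).1, e2, fun i => (Nat.le_floor_iff hT0).1 (e1 i).2⟩
  have hM1 : 1 ≤ M := by rw [hM, Nat.one_le_floor_iff]; exact hT
  have hMr : (1:ℝ) ≤ M := by exact_mod_cast hM1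
  have hcard := SFrob.card_lower hn M G hG'
  have hMn : (0:ℝ) < (M:ℝ)^n := by positivity
  have hGpos : (0:ℝ) < G.card := by linarith
  let I : Finset (Fin n × Fin n × ℕ) :=
    ((Finset.univ : Finset (Fin n)) ×ˢ (Finset.univ : Finset (Fin n)) ×ˢ Finset.Icc 1 M).filter
      (fun t => t.1 ≠ t.2.1)
  let Z : Fin n × Fin n × ℕ → (Fin n → ℕ) → ℝ := fun t a =>
    ((t.2.2 : ℝ) / a t.2.1) ^ β * SFrob.Y β t.2.2 a
  have hZ : ∀ t a, 0 ≤ Z t a := fun t a =>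
    mul_nonneg (by positivity) (SFrob.Y_nonneg _ _ _)
  have hpt : ∀ a ∈ G, (F a s : ℝ) / ((s : ℝ) * ∏ i, (a i : ℝ)) ^ (1 / d) ≤
      ∑ t ∈ I, if a ∈ SFrob.vecs n t.2.2 t.1 then C * Z t a else 0 := by
    intro a ha
    obtain ⟨ha1, ha2⟩ := (hG' a).1 ha
    have hne : (Finset.univ : Finset (Fin n)).Nonempty := ⟨⟨0, by omega⟩, Finset.mem_univ _⟩
    obtain ⟨p, _, hp⟩ := Finset.exists_max_image Finset.univ a hne
    have hne2 : (Finset.univ.erase p).Nonempty := by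
      rw [← Finset.card_pos, Finset.card_erase_of_mem (Finset.mem_univ p)]
      simp; omega
    obtain ⟨q, hqm, hq⟩ := Finset.exists_min_image (Finset.univ.erase p) a hne2
    have hpq : p ≠ q := (Finset.ne_of_mem_erase hqm).symm
    obtain ⟨ρ, hρ1, hρ2, hρ3, hρ4⟩ := SFrob.exists_rho β h0 h1 (a p) (ha1 p).1 a ha2
    have hFs := (hF a s (fun i => (ha1 i).1) ha2 hs).1
    have hb := hX a s (F a s) p q ρ (fun i => (ha1 i).1) hs hFs (fun i => hp i (Finset.mem_univ i))
      (fun i hi => hq i (Finset.mem_erase.2 ⟨hi, Finset.mem_univ i⟩)) hρ1 hρ2 hρ3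
    have hmem : a ∈ SFrob.vecs n (a p) p := by
      simp only [SFrob.vecs, Finset.mem_filter, Fintype.mem_piFinset]
      refine ⟨fun i => ?_, ha2⟩
      split_ifs with hi
      · simp [hi]
      · exact Finset.mem_Icc.2 ⟨(ha1 i).1, hp i (Finset.mem_univ i)⟩
    have htI : (p, q, a p) ∈ I := by
      simp only [I, Finset.mem_filter, Finset.mem_product, Finset.mem_univ, true_and,
        Finset.mem_Icc]
      exact ⟨ha1 p, hpq⟩
    calc _ ≤ C * Z (p, q, a p) a := by
          refine hb.trans (mul_le_mul_of_nonneg_left ?_ hC.le)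
          exact mul_le_mul_of_nonneg_left hρ4 (by positivity)
      _ = (if a ∈ SFrob.vecs n (p, q, a p).2.2 (p, q, a p).1 then C * Z (p, q, a p) a else 0) := by
          rw [if_pos hmem]
      _ ≤ _ := Finset.single_le_sum
          (f := fun t => if a ∈ SFrob.vecs n t.2.2 t.1 then C * Z t a else 0)
          (fun t _ => by
            have := hZ t a
            split_ifs <;> positivity) htI
  have hsum : ∑ a ∈ G, (F a s : ℝ) / ((s : ℝ) * ∏ i, (a i : ℝ)) ^ (1 / d) ≤
      (n:ℝ) * n * C * C' * (M:ℝ)^n := by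
    calc _ ≤ ∑ a ∈ G, ∑ t ∈ I, (if a ∈ SFrob.vecs n t.2.2 t.1 then C * Z t a else 0) :=
          Finset.sum_le_sum hpt
      _ = ∑ t ∈ I, ∑ a ∈ G, (if a ∈ SFrob.vecs n t.2.2 t.1 then C * Z t a else 0) :=
          Finset.sum_comm
      _ ≤ ∑ t ∈ I, C * (C' * (M:ℝ)^(n-1)) := by
          refine Finset.sum_le_sum fun t ht => ?_
          simp only [I, Finset.mem_filter, Finset.mem_product, Finset.mem_univ, true_and,
            Finset.mem_Icc] at ht
          obtain ⟨⟨ht1, ht2⟩, ht3⟩ := ht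
          rw [← Finset.sum_filter]
          calc _ ≤ ∑ a ∈ SFrob.vecs n t.2.2 t.1, C * Z t a := by
                refine Finset.sum_le_sum_of_subset_of_nonneg ?_
                  fun a _ _ => mul_nonneg hC.le (hZ t a)
                intro a ha
                exact (Finset.mem_filter.1 ha).2
            _ = C * ∑ a ∈ SFrob.vecs n t.2.2 t.1, Z t a := by rw [Finset.mul_sum]
            _ ≤ C * (C' * (t.2.2 : ℝ)^(n-1)) := by
                refine mul_le_mul_of_nonneg_left ?_ hC.le
                rw [hC']
                exact SFrob.Y_sum hn d β hd hβ h0 h1 t.1 t.2.1 ht3 t.2.2 ht1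
            _ ≤ _ := by
                have : (t.2.2 : ℝ) ≤ M := by exact_mod_cast ht2
                gcongr
      _ = (I.card : ℝ) * (C * (C' * (M:ℝ)^(n-1))) := by rw [Finset.sum_const, nsmul_eq_mul]
      _ ≤ ((n:ℝ) * (n * M)) * (C * (C' * (M:ℝ)^(n-1))) := by
          refine mul_le_mul_of_nonneg_right ?_ (by positivity)
          have : I.card ≤ n * (n * M) := by
            refine (Finset.card_filter_le _ _).trans ?_
            simp
          exact_mod_cast this
      _ = (n:ℝ) * n * C * C' * ((M:ℝ) * (M:ℝ)^(n-1)) := by ring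
      _ = _ := by rw [← pow_succ', Nat.sub_add_cancel (by omega)]
  rw [one_div_mul_eq_div, div_le_iff₀ hGpos]
  have hpos : 0 < (n:ℝ) * n * C * C' := by positivity
  calc _ ≤ (n:ℝ) * n * C * C' * (M:ℝ)^n := hsum
    _ ≤ (n:ℝ) * n * C * C' * (2 * G.card) := mul_le_mul_of_nonneg_left hcard hpos.le
    _ = _ := by ring
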